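/- arXiv:1912.02566 — 5 statements merged into one kernel-verified Lean document; each statement's English description precedes it below -/
import Mathlib

section
/- Let A ∈ ℝ^{n×p} with rows a_1,…,a_n, let f_1,…,f_n : ℝ → ℝ be convex and nonnegative, let R : ℝ^p → ℝ be convex, and let λ > 0. Define P(x) = (1/n) ∑_{i=1}^n f_i(⟨a_i, x⟩) + λ R(x) and D(ν) = (1/n) ∑_{i=1}^n (− f_i*(ν_i)) − λ R*(− Aᵀν/(λn)), and suppose P(x*) = D(ν*) (with all conjugate values finite). Fix an index i, and suppose there is a nonempty open interval I ⊆ ℝ such that f_i(t) = 0 for all t ∈ I. If ⟨a_i, x*⟩ ∈ I, then ν*_i = 0. (SAFE screening rule: the data point (a_i, b_i) can be safely discarded.) -/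
open Matrix

/-- Fenchel conjugate of a scalar function. -/
noncomputable def conj1 (f : ℝ → ℝ) (y : ℝ) : ℝ := ⨆ t : ℝ, (t * y - f t)

/-- Fenchel conjugate of a function on `ℝ^d` (with the dot product pairing). -/
noncomputable def conjV {d : ℕ} (R : (Fin d → ℝ) → ℝ) (y : Fin d → ℝ) : ℝ :=
  ⨆ x : Fin d → ℝ, (x ⬝ᵥ y - R x)

/-- The Fenchel–Young inequality for scalar functions. -/
theorem fenchel_young_conj1 {f : ℝ → ℝ} {y : ℝ}
    (h : BddAbove (Set.range fun t : ℝ => t * y - f t)) (t : ℝ) :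
    t * y ≤ f t + conj1 f y := by
  have := le_ciSup h t
  simp only [conj1]
  linarith

/-- The Fenchel–Young inequality on `ℝ^d`. -/
theorem fenchel_young_conjV {d : ℕ} {R : (Fin d → ℝ) → ℝ} {y : Fin d → ℝ}
    (h : BddAbove (Set.range fun x : Fin d → ℝ => x ⬝ᵥ y - R x)) (x : Fin d → ℝ) :
    x ⬝ᵥ y ≤ R x + conjV R y := by
  have := le_ciSup h x
  simp only [conjV]
  linarith

/-- A linear function with a local maximum in an open interval has zero slope. -/
theorem slope_eq_zero_of_forall_mul_le {c d u y : ℝ} (hu : u ∈ Set.Ioo c d)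
    (h : ∀ t ∈ Set.Ioo c d, t * y ≤ u * y) : y = 0 := by
  obtain ⟨hcu, hud⟩ := hu
  have h₁ := h ((c + u) / 2) ⟨by linarith, by linarith⟩
  have h₂ := h ((u + d) / 2) ⟨by linarith, by linarith⟩
  apply le_antisymm
  · by_contra! hy
    nlinarith
  · by_contra! hy
    nlinarith

/-- If the primal and dual objectives agree, every Fenchel–Young inequality for the losses
is an equality. -/
theorem conj1_eq_of_primal_eq_dual {n p : ℕ} (hn : 0 < n) (A : Matrix (Fin n) (Fin p) ℝ)
    (f : Fin n → ℝ → ℝ) (R : (Fin p → ℝ) → ℝ) {lam : ℝ} (hlam : 0 < lam)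
    (xs : Fin p → ℝ) (nus : Fin n → ℝ)
    (hfin : ∀ i, BddAbove (Set.range fun t : ℝ => t * nus i - f i t))
    (hRfin : BddAbove (Set.range fun x : Fin p → ℝ =>
        x ⬝ᵥ ((lam * (n : ℝ))⁻¹ • (-(Aᵀ *ᵥ nus))) - R x))
    (hdual : (1 / (n : ℝ)) * ∑ i, f i (A i ⬝ᵥ xs) + lam * R xs
      = (1 / (n : ℝ)) * ∑ i, (-(conj1 (f i) (nus i)))
        - lam * conjV R ((lam * (n : ℝ))⁻¹ • (-(Aᵀ *ᵥ nus))))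
    (i : Fin n) :
    f i (A i ⬝ᵥ xs) + conj1 (f i) (nus i) = (A i ⬝ᵥ xs) * nus i := by
  have hn' : (0 : ℝ) < n := by exact_mod_cast hn
  have hR := mul_le_mul_of_nonneg_left (fenchel_young_conjV hRfin xs) hlam.le
  have hpair : lam * (xs ⬝ᵥ ((lam * (n : ℝ))⁻¹ • (-(Aᵀ *ᵥ nus))))
      = -((1 / (n : ℝ)) * ∑ j, (A j ⬝ᵥ xs) * nus j) := by
    have hswap : xs ⬝ᵥ (Aᵀ *ᵥ nus) = ∑ j, (A j ⬝ᵥ xs) * nus j := by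
      rw [dotProduct_mulVec, vecMul_transpose]
      rfl
    rw [dotProduct_smul, dotProduct_neg, hswap, smul_eq_mul]
    field_simp
  have hgap : ∀ j ∈ Finset.univ,
      0 ≤ f j (A j ⬝ᵥ xs) + conj1 (f j) (nus j) - (A j ⬝ᵥ xs) * nus j :=
    fun j _ => sub_nonneg.2 (fenchel_young_conj1 (hfin j) _)
  have hsum : (1 / (n : ℝ)) *
      ∑ j, (f j (A j ⬝ᵥ xs) + conj1 (f j) (nus j) - (A j ⬝ᵥ xs) * nus j) ≤ 0 := by
    rw [Finset.sum_neg_distrib] at hdual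
    rw [Finset.sum_sub_distrib, Finset.sum_add_distrib]
    linarith
  have hzero := le_antisymm (nonpos_of_mul_nonpos_right hsum (by positivity))
    (Finset.sum_nonneg hgap)
  exact sub_eq_zero.1 ((Finset.sum_eq_zero_iff_of_nonneg hgap).1 hzero i (Finset.mem_univ i))


/-- SAFE screening rule: if the loss `f i` is a safe loss (vanishing on a nonempty open
interval) and the prediction `⟨a_i, x*⟩` lies in that interval, then the optimal dual
coordinate `ν*_i` is zero, so the data point can be safely discarded. -/
theorem safe_screening_rule
    {n p : ℕ} (hn : 0 < n) (A : Matrix (Fin n) (Fin p) ℝ)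
    (f : Fin n → ℝ → ℝ) (hf : ∀ i, ConvexOn ℝ Set.univ (f i))
    (hfpos : ∀ i t, 0 ≤ f i t)
    (R : (Fin p → ℝ) → ℝ) (hR : ConvexOn ℝ Set.univ R)
    (lam : ℝ) (hlam : 0 < lam)
    (xs : Fin p → ℝ) (nus : Fin n → ℝ)
    (hfin : ∀ i, BddAbove (Set.range fun t : ℝ => t * nus i - f i t))
    (hRfin : BddAbove (Set.range fun x : Fin p → ℝ =>
        x ⬝ᵥ ((lam * (n : ℝ))⁻¹ • (-(Aᵀ *ᵥ nus))) - R x))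
    (hdual : (1 / (n : ℝ)) * ∑ i, f i (A i ⬝ᵥ xs) + lam * R xs
      = (1 / (n : ℝ)) * ∑ i, (-(conj1 (f i) (nus i)))
        - lam * conjV R ((lam * (n : ℝ))⁻¹ • (-(Aᵀ *ᵥ nus))))
    (i : Fin n) (c d : ℝ) (hcd : c < d)
    (hflat : ∀ t ∈ Set.Ioo c d, f i t = 0)
    (hmem : A i ⬝ᵥ xs ∈ Set.Ioo c d) :
    nus i = 0 := by
  have heq := conj1_eq_of_primal_eq_dual hn A f R hlam xs nus hfin hRfin hdual i
  refine slope_eq_zero_of_forall_mul_le hmem fun t ht => ?_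
  have hle := fenchel_young_conj1 (hfin i) t
  rw [hflat _ hmem] at heq
  rw [hflat t ht] at hle
  linarith
end

section
/- Let E ∈ ℝ^{p×p} be symmetric positive definite, let z, a, g ∈ ℝ^p with g ≠ 0, and let b ∈ ℝ. Consider the maximum of ⟨a, x⟩ − b over the cut ellipsoid {x ∈ ℝ^p : (x − z)ᵀ E^{-1} (x − z) ≤ 1 and ⟨g, x − z⟩ ≤ 0}. If gᵀ E a ≤ 0, the maximum equals ⟨a, z⟩ + (aᵀ E a)^{1/2} − b. If gᵀ E a > 0, the maximum equals ⟨a, z⟩ + (wᵀ E w)^{1/2} − b, where w = a − ν g with ν = (gᵀ E a)/(gᵀ E g). -/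
open Matrix

namespace Matrix.PosDef

variable {n : Type*} [Fintype n] {E : Matrix n n ℝ}

lemma dotProduct_mulVec_comm (hE : E.PosDef) (x y : n → ℝ) :
    x ⬝ᵥ (E *ᵥ y) = y ⬝ᵥ (E *ᵥ x) := by
  have hT : Eᵀ = E := by simpa using hE.isHermitian.eq
  rw [dotProduct_comm, dotProduct_mulVec, ← mulVec_transpose, hT, dotProduct_comm]

lemma dotProduct_mulVec_self_nonneg (hE : E.PosDef) (x : n → ℝ) : 0 ≤ x ⬝ᵥ (E *ᵥ x) := by
  simpa using hE.posSemidef.dotProduct_mulVec_nonneg x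

lemma dotProduct_mulVec_self_pos (hE : E.PosDef) {x : n → ℝ} (hx : x ≠ 0) :
    0 < x ⬝ᵥ (E *ᵥ x) := by
  simpa using hE.dotProduct_mulVec_pos hx

variable [DecidableEq n]

lemma mulVec_inv_mulVec (hE : E.PosDef) (u : n → ℝ) : E *ᵥ (E⁻¹ *ᵥ u) = u := by
  rw [mulVec_mulVec, mul_nonsing_inv _ ((isUnit_iff_isUnit_det E).1 hE.isUnit), one_mulVec]

lemma inv_mulVec_mulVec (hE : E.PosDef) (u : n → ℝ) : E⁻¹ *ᵥ (E *ᵥ u) = u := by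
  rw [mulVec_mulVec, nonsing_inv_mul _ ((isUnit_iff_isUnit_det E).1 hE.isUnit), one_mulVec]

/-- The support function of the ellipsoid with shape matrix `E` centered at the origin is bounded
by the `E`-norm. -/
lemma dotProduct_le_sqrt (hE : E.PosDef) (w u : n → ℝ) (hu : u ⬝ᵥ (E⁻¹ *ᵥ u) ≤ 1) :
    w ⬝ᵥ u ≤ √(w ⬝ᵥ (E *ᵥ w)) := by
  obtain ⟨v, rfl⟩ : ∃ v, u = E *ᵥ v := ⟨_, (hE.mulVec_inv_mulVec u).symm⟩
  rw [hE.inv_mulVec_mulVec, dotProduct_comm] at hu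
  rcases eq_or_ne w 0 with rfl | hw
  · simp
  have hpos := hE.dotProduct_mulVec_self_pos hw
  have hs := Real.sqrt_pos.2 hpos
  have hsq := Real.sq_sqrt hpos.le
  set s := √(w ⬝ᵥ (E *ᵥ w))
  have h := hE.dotProduct_mulVec_self_nonneg (w - s • v)
  simp only [mulVec_sub, mulVec_smul, sub_dotProduct, dotProduct_sub, smul_dotProduct,
    dotProduct_smul, smul_eq_mul, hE.dotProduct_mulVec_comm v w] at h
  have h' : s * (w ⬝ᵥ (E *ᵥ v)) ≤ s * s := by
    nlinarith [mul_le_mul_of_nonneg_left hu (sq_nonneg s)]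
  exact le_of_mul_le_mul_left h' hs

/-- Optimality certificate for a linear form `w + ν • g` over the cut ellipsoid: `ν` is the
multiplier of the half-space constraint, with complementary slackness `hslack`. -/
lemma isGreatest_cut_ellipsoid (hE : E.PosDef) (z w g : n → ℝ) (b : ℝ) {ν : ℝ} (hν : 0 ≤ ν)
    (hw : g ⬝ᵥ (E *ᵥ w) ≤ 0) (hslack : ν * (g ⬝ᵥ (E *ᵥ w)) = 0) :
    IsGreatest ((fun x : n → ℝ => (w + ν • g) ⬝ᵥ x - b) ''
        {x : n → ℝ | (x - z) ⬝ᵥ (E⁻¹ *ᵥ (x - z)) ≤ 1 ∧ g ⬝ᵥ (x - z) ≤ 0})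
      ((w + ν • g) ⬝ᵥ z + √(w ⬝ᵥ (E *ᵥ w)) - b) := by
  constructor
  · have hsq := Real.mul_self_sqrt (hE.dotProduct_mulVec_self_nonneg w)
    have hs := Real.sqrt_nonneg (w ⬝ᵥ (E *ᵥ w))
    set s := √(w ⬝ᵥ (E *ᵥ w))
    refine ⟨z + s⁻¹ • (E *ᵥ w), ⟨?_, ?_⟩, ?_⟩
    · simp only [add_sub_cancel_left, mulVec_smul, hE.inv_mulVec_mulVec, smul_dotProduct,
        dotProduct_smul, smul_eq_mul]
      rw [dotProduct_comm, ← hsq]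
      rcases eq_or_ne s 0 with h | h
      · simp [h]
      · field_simp
        exact le_rfl
    · simp only [add_sub_cancel_left, dotProduct_smul, smul_eq_mul]
      exact mul_nonpos_of_nonneg_of_nonpos (inv_nonneg.2 hs) hw
    · have hval : (w + ν • g) ⬝ᵥ (s⁻¹ • (E *ᵥ w)) = s := by
        simp only [add_dotProduct, smul_dotProduct, dotProduct_smul, smul_eq_mul]
        rw [hslack, add_zero, ← hsq]
        rcases eq_or_ne s 0 with h | h
        · simp [h]
        · field_simp
      simp only [dotProduct_add _ z, hval]
  · rintro _ ⟨x, ⟨hx, hgx⟩, rfl⟩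
    have h := hE.dotProduct_le_sqrt w (x - z) hx
    have h' := mul_nonpos_of_nonneg_of_nonpos hν hgx
    simp only [dotProduct_sub, add_dotProduct, smul_dotProduct, smul_eq_mul] at h h' ⊢
    linarith

end Matrix.PosDef

/-- Closed-form screening test: maximizing a linear form over an ellipsoid cut by a
half-space through its center. -/
theorem max_linear_form_over_cut_ellipsoid
    {p : ℕ} (E : Matrix (Fin p) (Fin p) ℝ) (hE : E.PosDef)
    (z a g : Fin p → ℝ) (hg : g ≠ 0) (b : ℝ) :
    (g ⬝ᵥ (E *ᵥ a) ≤ 0 →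
      IsGreatest ((fun x : Fin p → ℝ => a ⬝ᵥ x - b) ''
          {x : Fin p → ℝ | (x - z) ⬝ᵥ (E⁻¹ *ᵥ (x - z)) ≤ 1 ∧ g ⬝ᵥ (x - z) ≤ 0})
        (a ⬝ᵥ z + Real.sqrt (a ⬝ᵥ (E *ᵥ a)) - b)) ∧
    (0 < g ⬝ᵥ (E *ᵥ a) →
      IsGreatest ((fun x : Fin p → ℝ => a ⬝ᵥ x - b) ''
          {x : Fin p → ℝ | (x - z) ⬝ᵥ (E⁻¹ *ᵥ (x - z)) ≤ 1 ∧ g ⬝ᵥ (x - z) ≤ 0})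
        (a ⬝ᵥ z +
          Real.sqrt ((a - ((g ⬝ᵥ (E *ᵥ a)) / (g ⬝ᵥ (E *ᵥ g))) • g) ⬝ᵥ
            (E *ᵥ (a - ((g ⬝ᵥ (E *ᵥ a)) / (g ⬝ᵥ (E *ᵥ g))) • g))) - b)) := by
  constructor
  · intro h
    simpa using hE.isGreatest_cut_ellipsoid z a g b le_rfl h (zero_mul _)
  · intro h
    have hgg := hE.dotProduct_mulVec_self_pos hg
    set ν := (g ⬝ᵥ (E *ᵥ a)) / (g ⬝ᵥ (E *ᵥ g)) with hν
    have horth : g ⬝ᵥ (E *ᵥ (a - ν • g)) = 0 := by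
      rw [mulVec_sub, mulVec_smul, dotProduct_sub, dotProduct_smul, smul_eq_mul, hν,
        div_mul_cancel₀ _ hgg.ne', sub_self]
    have key := hE.isGreatest_cut_ellipsoid z (a - ν • g) g b (div_pos h hgg).le horth.le
      (mul_eq_zero_of_right _ horth)
    rwa [sub_add_cancel] at key
end

section
/- For every μ ≥ 0 and every t ∈ ℝ, inf { |1 − z| : z ∈ ℝ, z ≤ t + μ } = max(1 − t − μ, 0). In other words, the infimum convolution of the robust loss z ↦ |1 − z| with the conjugate of Ω(x) = ‖x‖₁ + 1_{x ≤ 0} produces the (shifted) hinge loss [1 − t − μ]₊. -/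
/-- The infimum convolution of the robust loss `z ↦ |1 − z|` with the conjugate of
`Ω(x) = ‖x‖₁ + 1_{x ≼ 0}` produces the (shifted) hinge loss `[1 − t − μ]₊`. -/
theorem inf_conv_abs_is_hinge (μ : ℝ) (hμ : 0 ≤ μ) (t : ℝ) :
    sInf ((fun z : ℝ => |1 - z|) '' {z : ℝ | z ≤ t + μ}) = max (1 - t - μ) 0 := by
  refine IsLeast.csInf_eq ⟨⟨min 1 (t + μ), min_le_right 1 (t + μ), ?_⟩, ?_⟩
  · rcases le_total 1 (t + μ) with h | h
    · simp [min_eq_left h, max_eq_right (by linarith : 1 - t - μ ≤ 0)]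
    · rw [max_eq_left (by linarith), min_eq_right h]
      simp only [abs_of_nonneg (sub_nonneg.2 h), sub_sub]
  · rintro _ ⟨z, hz : z ≤ t + μ, rfl⟩
    exact max_le (le_trans (by linarith) (le_abs_self (1 - z))) (abs_nonneg _)
end

section
/- For μ ≥ 0, define the safe logistic loss f_μ : ℝ → ℝ by f_μ(x) = e^{x + μ − 1} − (x + μ) if x + μ − 1 ≤ 0, and f_μ(x) = 0 otherwise. Then f_μ is convex, nonnegative, continuously differentiable on ℝ, and f_μ(x) = 0 if and only if x ≥ 1 − μ. In particular f_μ is a safe loss: it vanishes exactly on the non-singleton interval [1 − μ, +∞). -/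
/-- The normalized safe logistic loss `t ↦ exp (min t 0) - 1 - min t 0` is differentiable,
with derivative `t ↦ exp (min t 0) - 1`. -/
theorem hasDerivAt_exp_min_sub_one_sub_min (t : ℝ) :
    HasDerivAt (fun t : ℝ => Real.exp (min t 0) - 1 - min t 0) (Real.exp (min t 0) - 1) t := by
  have key : ∀ y : ℝ, y ≠ 0 →
      HasDerivAt (fun t : ℝ => Real.exp (min t 0) - 1 - min t 0) (Real.exp (min y 0) - 1) y := by
    intro y hy
    rcases lt_or_gt_of_ne hy with hy | hy
    · have h : HasDerivAt (fun t : ℝ => Real.exp t - 1 - t) (Real.exp y - 1) y :=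
        ((Real.hasDerivAt_exp y).sub_const 1).sub (hasDerivAt_id y)
      rw [min_eq_left hy.le]
      refine h.congr_of_eventuallyEq ?_
      filter_upwards [Iio_mem_nhds hy] with z hz
      rw [min_eq_left (le_of_lt hz)]
    · have h : HasDerivAt (fun _ : ℝ => (0 : ℝ)) 0 y := hasDerivAt_const y 0
      rw [min_eq_right hy.le, Real.exp_zero, sub_self]
      refine h.congr_of_eventuallyEq ?_
      filter_upwards [Ioi_mem_nhds hy] with z hz
      simp [min_eq_right (Set.mem_Ioi.mp hz).le]
  rcases eq_or_ne t 0 with rfl | ht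
  · exact hasDerivAt_of_hasDerivAt_of_ne (g := fun t : ℝ => Real.exp (min t 0) - 1) key
      (by fun_prop) (by fun_prop)
  · exact key t ht

/-- The safe logistic loss is convex, nonnegative, continuously differentiable, and
vanishes exactly on the non-singleton interval `[1 − μ, +∞)`: it is a safe loss. -/
theorem safe_logistic_loss_properties (μ : ℝ) (hμ : 0 ≤ μ)
    (fμ : ℝ → ℝ)
    (hfμ : ∀ x, fμ x = if x + μ - 1 ≤ 0 then Real.exp (x + μ - 1) - (x + μ) else 0) :
    ConvexOn ℝ Set.univ fμ ∧
    (∀ x, 0 ≤ fμ x) ∧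
    ContDiff ℝ 1 fμ ∧
    (∀ x, fμ x = 0 ↔ 1 - μ ≤ x) := by
  have hf : fμ = fun x => Real.exp (min (x + (μ - 1)) 0) - 1 - min (x + (μ - 1)) 0 := by
    funext x
    rw [hfμ, ← add_sub_assoc]
    split_ifs with h
    · rw [min_eq_left h]; ring
    · rw [min_eq_right (not_le.mp h).le]; simp
  have hderiv : ∀ x, HasDerivAt fμ (Real.exp (min (x + (μ - 1)) 0) - 1) x := by
    intro x
    rw [hf]
    exact (hasDerivAt_exp_min_sub_one_sub_min (x + (μ - 1))).comp_add_const x (μ - 1)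
  have hdiff : Differentiable ℝ fμ := fun x => (hderiv x).differentiableAt
  have hd : deriv fμ = fun x => Real.exp (min (x + (μ - 1)) 0) - 1 :=
    funext fun x => (hderiv x).deriv
  refine ⟨?_, fun x => ?_, ?_, fun x => ?_⟩
  · refine Monotone.convexOn_univ_of_deriv hdiff ?_
    rw [hd]
    intro a b hab
    dsimp only
    gcongr
  · have := Real.add_one_le_exp (min (x + (μ - 1)) 0)
    rw [hf]
    linarith
  · rw [contDiff_one_iff_deriv, hd]
    exact ⟨hdiff, by fun_prop⟩
  · rw [hf]
    dsimp only
    constructor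
    · intro h
      by_contra! hx
      rw [min_eq_left (by linarith)] at h
      have := Real.add_one_lt_exp (x := x + (μ - 1)) (by linarith)
      linarith
    · intro h
      simp [min_eq_right (show (0 : ℝ) ≤ x + (μ - 1) by linarith)]
end

section
/- Let p ≥ 2, let E ∈ ℝ^{p×p} be symmetric positive definite, let g ∈ ℝ^p with g ≠ 0, g̃ = g / (gᵀ E g)^{1/2}, and E⁺ = (p²/(p² − 1)) ( E − (2/(p+1)) E g̃ g̃ᵀ E ). Then the volume ratio of the updated ellipsoid to the original satisfies (det E⁺ / det E)^{1/2} = ( p²/(p²−1) )^{p/2} ( (p−1)/(p+1) )^{1/2} ≤ e^{−1/(2(p+1))} < 1; in particular the volume of the ellipsoid strictly decreases at each step of the ellipsoid method. -/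
open Matrix

/-- The determinant of a rank-one downdate of the form `E - c E v vᵀ E`. -/
theorem Matrix.det_sub_smul_mul_vecMulVec_mul {n R : Type*} [Fintype n] [DecidableEq n]
    [CommRing R] (E : Matrix n n R) (v : n → R) (c : R) :
    (E - c • (E * vecMulVec v v * E)).det = E.det * (1 - c * (v ⬝ᵥ (E *ᵥ v))) := by
  have factor : E - c • (E * vecMulVec v v * E)
      = E * (1 + replicateCol Unit (-c • v) * replicateRow Unit (v ᵥ* E)) := by
    rw [← vecMulVec_eq, smul_vecMulVec, ← vecMulVec_mul, Matrix.mul_add, Matrix.mul_one,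
      Matrix.mul_smul, neg_smul, ← sub_eq_add_neg, Matrix.mul_assoc]
  rw [factor, det_mul, det_one_add_replicateCol_mul_replicateRow, dotProduct_smul,
    ← dotProduct_mulVec, smul_eq_mul, neg_mul, ← sub_eq_add_neg]

/-- Normalizing a vector in the norm of a quadratic form yields a unit vector. -/
theorem Matrix.dotProduct_mulVec_inv_sqrt_smul {n : Type*} [Fintype n] (E : Matrix n n ℝ)
    (g : n → ℝ) (hg : 0 < g ⬝ᵥ (E *ᵥ g)) :
    ((Real.sqrt (g ⬝ᵥ (E *ᵥ g)))⁻¹ • g) ⬝ᵥ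
      (E *ᵥ ((Real.sqrt (g ⬝ᵥ (E *ᵥ g)))⁻¹ • g)) = 1 := by
  rw [mulVec_smul, dotProduct_smul, smul_dotProduct, smul_eq_mul, smul_eq_mul, ← mul_assoc,
    ← mul_inv, Real.mul_self_sqrt hg.le, inv_mul_cancel₀ hg.ne']

/-- The squared volume ratio of one ellipsoid step is at most `e^{-1/(p+1)}`. -/
theorem ellipsoid_sq_volume_ratio_le_exp {p : ℕ} (hp : 2 ≤ p) :
    ((p : ℝ) ^ 2 / ((p : ℝ) ^ 2 - 1)) ^ p * (((p : ℝ) - 1) / ((p : ℝ) + 1))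
      ≤ Real.exp (-1 / ((p : ℝ) + 1)) := by
  obtain ⟨n, rfl⟩ : ∃ n, p = n + 1 := ⟨p - 1, by lia⟩
  have hn : (0 : ℝ) < n := by exact_mod_cast (show 0 < n by lia)
  push_cast
  have hd : ((n : ℝ) + 1) ^ 2 - 1 = n * (n + 2) := by ring
  have hr : ((n : ℝ) + 1) ^ 2 / (((n : ℝ) + 1) ^ 2 - 1) ≤ Real.exp (1 / (n * (n + 2))) := by
    refine le_of_eq_of_le ?_ (Real.add_one_le_exp _)
    rw [hd]
    field_simp
    ring
  have hs : ((n : ℝ) + 1) / (n + 2) ≤ Real.exp (-1 / (n + 2)) := by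
    refine le_of_eq_of_le ?_ (Real.add_one_le_exp _)
    field_simp
    ring
  have hr₀ : 0 ≤ ((n : ℝ) + 1) ^ 2 / (((n : ℝ) + 1) ^ 2 - 1) := by
    rw [hd]
    positivity
  calc _ = (((n : ℝ) + 1) ^ 2 / (((n : ℝ) + 1) ^ 2 - 1)) ^ n * (((n : ℝ) + 1) / (n + 2)) ^ 2 := by
        rw [pow_succ, mul_assoc, hd]
        congr 1
        field_simp
        ring
    _ ≤ Real.exp (1 / (n * (n + 2))) ^ n * Real.exp (-1 / (n + 2)) ^ 2 := by gcongr
    _ = _ := by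
        rw [← Real.exp_nat_mul, ← Real.exp_nat_mul, ← Real.exp_add]
        congr 1
        push_cast
        field_simp
        ring

/-- Volume decrease of the ellipsoid method: the volume ratio
`(det E⁺ / det E)^{1/2}` equals `(p²/(p²−1))^{p/2} ((p−1)/(p+1))^{1/2}`, which is at
most `e^{−1/(2(p+1))} < 1`. -/
theorem ellipsoid_method_volume_decrease
    {p : ℕ} (hp : 2 ≤ p) (E : Matrix (Fin p) (Fin p) ℝ) (hE : E.PosDef)
    (g : Fin p → ℝ) (hg : g ≠ 0) :
    let gt : Fin p → ℝ := (Real.sqrt (g ⬝ᵥ (E *ᵥ g)))⁻¹ • g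
    let Eplus : Matrix (Fin p) (Fin p) ℝ :=
      ((p : ℝ) ^ 2 / ((p : ℝ) ^ 2 - 1)) •
        (E - (2 / ((p : ℝ) + 1)) • (E * Matrix.vecMulVec gt gt * E))
    Real.sqrt (Eplus.det / E.det)
      = ((p : ℝ) ^ 2 / ((p : ℝ) ^ 2 - 1)) ^ ((p : ℝ) / 2) *
          Real.sqrt (((p : ℝ) - 1) / ((p : ℝ) + 1)) ∧
    ((p : ℝ) ^ 2 / ((p : ℝ) ^ 2 - 1)) ^ ((p : ℝ) / 2) *
        Real.sqrt (((p : ℝ) - 1) / ((p : ℝ) + 1))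
      ≤ Real.exp (-1 / (2 * ((p : ℝ) + 1))) ∧
    Real.exp (-1 / (2 * ((p : ℝ) + 1))) < 1 := by
  intro gt Eplus
  have hp' : (2 : ℝ) ≤ p := by exact_mod_cast hp
  have hr : 0 ≤ (p : ℝ) ^ 2 / ((p : ℝ) ^ 2 - 1) := div_nonneg (by positivity) (by nlinarith)
  have hgt : gt ⬝ᵥ (E *ᵥ gt) = 1 :=
    E.dotProduct_mulVec_inv_sqrt_smul g (by simpa using hE.dotProduct_mulVec_pos hg)
  have hdet : Eplus.det / E.det
      = ((p : ℝ) ^ 2 / ((p : ℝ) ^ 2 - 1)) ^ p * (((p : ℝ) - 1) / ((p : ℝ) + 1)) := by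
    have hE₀ : E.det ≠ 0 := hE.det_pos.ne'
    have hc : 1 - 2 / ((p : ℝ) + 1) * 1 = ((p : ℝ) - 1) / ((p : ℝ) + 1) := by
      field_simp
      ring
    rw [det_smul, Fintype.card_fin, det_sub_smul_mul_vecMulVec_mul, hgt, hc, mul_left_comm,
      mul_div_cancel_left₀ _ hE₀]
  have hsqrt : Real.sqrt (((p : ℝ) ^ 2 / ((p : ℝ) ^ 2 - 1)) ^ p * (((p : ℝ) - 1) / ((p : ℝ) + 1)))
      = ((p : ℝ) ^ 2 / ((p : ℝ) ^ 2 - 1)) ^ ((p : ℝ) / 2) *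
          Real.sqrt (((p : ℝ) - 1) / ((p : ℝ) + 1)) := by
    rw [Real.sqrt_mul (pow_nonneg hr p), Real.sqrt_eq_rpow, ← Real.rpow_natCast,
      ← Real.rpow_mul hr, mul_one_div]
  refine ⟨by rw [hdet, hsqrt], ?_, ?_⟩
  · rw [← hsqrt, mul_comm 2, ← div_div, Real.exp_half]
    exact Real.sqrt_le_sqrt (ellipsoid_sq_volume_ratio_le_exp hp)
  · rw [Real.exp_lt_one_iff]
    exact div_neg_of_neg_of_pos (by norm_num) (by positivity)
end
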